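/- For every bounded open set D ⊆ ℝ² there exists a constant C ≥ 0 such that for all smooth (C^∞) compactly supported vector fields u, v, w : ℝ² → ℝ² whose supports are contained in D, one has |b̂(u, v, w)| ≤ C · ‖u‖_{H¹} · ‖v‖_{H¹} · ‖w‖_{H¹}, where ‖u‖_{H¹} := (‖u‖_{L²}² + ‖∇u‖_{L²}²)^{1/2}. In particular b̂ is a continuous trilinear form with respect to the H¹-norm on such fields. -/

import Mathlib

open MeasureTheory

/-- Partial derivative `∂_j f` of a scalar function on `ℝ²`. -/
noncomputable def pderiv2 (j : Fin 2) (f : (Fin 2 → ℝ) → ℝ) (x : Fin 2 → ℝ) : ℝ :=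
  fderiv ℝ f x (Pi.single j 1)

/-- The trilinear form
`b̂(u,v,w) = ∫ ((u·∇)v)·w + (1/2) ∫ (div u)(v·w)` on `ℝ²`. -/
noncomputable def bhat (u v w : (Fin 2 → ℝ) → (Fin 2 → ℝ)) : ℝ :=
  (∫ x : Fin 2 → ℝ,
      ∑ i : Fin 2, (∑ j : Fin 2, u x j * pderiv2 j (fun y => v y i) x) * w x i) +
  (1 / 2) * ∫ x : Fin 2 → ℝ,
      (∑ j : Fin 2, pderiv2 j (fun y => u y j) x) * (∑ i : Fin 2, v x i * w x i)

/-- The squared `L²`-norm of a vector field on `ℝ²`. -/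
noncomputable def l2normSq (u : (Fin 2 → ℝ) → (Fin 2 → ℝ)) : ℝ :=
  ∫ x : Fin 2 → ℝ, ∑ i : Fin 2, (u x i) ^ 2

/-- The squared `L²`-norm of the gradient of a vector field on `ℝ²`. -/
noncomputable def gradL2normSq (u : (Fin 2 → ℝ) → (Fin 2 → ℝ)) : ℝ :=
  ∑ i : Fin 2, ∑ j : Fin 2, ∫ x : Fin 2 → ℝ, (pderiv2 j (fun y => u y i) x) ^ 2

/-- The `H¹`-norm `(‖u‖_{L²}² + ‖∇u‖_{L²}²)^{1/2}` of a vector field on `ℝ²`. -/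
noncomputable def h1norm (u : (Fin 2 → ℝ) → (Fin 2 → ℝ)) : ℝ :=
  Real.sqrt (l2normSq u + gradL2normSq u)

lemma hasCompactSupport_fun_pow {f : (Fin 2 → ℝ) → ℝ} (hf : HasCompactSupport f) {n : ℕ}
    (hn : n ≠ 0) : HasCompactSupport fun x => f x ^ n :=
  hf.mono fun x hx h0 => hx (by simp only [h0, zero_pow hn])

lemma integrable_fun_pow {f : (Fin 2 → ℝ) → ℝ} (hf : Continuous f) (hcf : HasCompactSupport f)
    {n : ℕ} (hn : n ≠ 0) : Integrable fun x => f x ^ n :=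
  (Continuous.pow hf n).integrable_of_hasCompactSupport (hasCompactSupport_fun_pow hcf hn)

lemma integrable_fun_mul {f g : (Fin 2 → ℝ) → ℝ} (hf : Continuous f) (hg : Continuous g)
    (hcg : HasCompactSupport g) : Integrable fun x => f x * g x :=
  (Continuous.mul hf hg).integrable_of_hasCompactSupport (HasCompactSupport.mul_left hcg)

/-- The Cauchy–Schwarz inequality for continuous compactly supported functions. -/
lemma sq_integral_mul_le {f g : (Fin 2 → ℝ) → ℝ} (hf : Continuous f) (hg : Continuous g)
    (hcf : HasCompactSupport f) (hcg : HasCompactSupport g) :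
    (∫ x, f x * g x) ^ 2 ≤ (∫ x, f x ^ 2) * ∫ x, g x ^ 2 := by
  have iff : Integrable (fun x => f x ^ 2) :=
    integrable_fun_pow hf hcf (by norm_num)
  have igg : Integrable (fun x => g x ^ 2) :=
    integrable_fun_pow hg hcg (by norm_num)
  have ifg : Integrable (fun x => f x * g x) :=
    integrable_fun_mul hf hg hcg
  have key : ∀ t : ℝ, 0 ≤ (∫ x, f x ^ 2) * (t * t) + (2 * ∫ x, f x * g x) * t
      + ∫ x, g x ^ 2 := by
    intro t
    have h : ∫ x, (t * f x + g x) ^ 2 = (∫ x, f x ^ 2) * (t * t) + (2 * ∫ x, f x * g x) * t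
        + ∫ x, g x ^ 2 := by
      have : ∀ x, (t * f x + g x) ^ 2 = f x ^ 2 * (t * t) + f x * g x * (2 * t) + g x ^ 2 :=
        fun x => by ring
      simp_rw [this]
      have isum : Integrable fun x => f x ^ 2 * (t * t) + f x * g x * (2 * t) :=
        (iff.mul_const _).add (ifg.mul_const _)
      rw [integral_add isum igg,
        integral_add (iff.mul_const _) (ifg.mul_const _), integral_mul_const, integral_mul_const]
      ring
    rw [← h]
    exact integral_nonneg fun x => sq_nonneg _
  have := discrim_le_zero key
  rw [discrim] at this
  nlinarith

lemma norm_le_sum_abs_apply_single (L : (Fin 2 → ℝ) →L[ℝ] ℝ) :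
    ‖L‖ ≤ |L (Pi.single 0 1)| + |L (Pi.single 1 1)| := by
  refine L.opNorm_le_bound (by positivity) fun x => ?_
  have hx : x = x 0 • Pi.single (0 : Fin 2) (1 : ℝ) + x 1 • Pi.single (1 : Fin 2) (1 : ℝ) := by
    ext i; fin_cases i <;> simp
  have h0 : |x 0| ≤ ‖x‖ := norm_le_pi_norm x 0
  have h1 : |x 1| ≤ ‖x‖ := norm_le_pi_norm x 1
  calc ‖L x‖ = |x 0 * L (Pi.single 0 1) + x 1 * L (Pi.single 1 1)| := by
        conv_lhs => rw [hx]
        rw [map_add, map_smul, map_smul]; rfl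
    _ ≤ |x 0| * |L (Pi.single 0 1)| + |x 1| * |L (Pi.single 1 1)| := by
        rw [← abs_mul, ← abs_mul]; exact abs_add_le _ _
    _ ≤ ‖x‖ * |L (Pi.single 0 1)| + ‖x‖ * |L (Pi.single 1 1)| := by gcongr
    _ = _ := by ring

lemma continuous_pderiv2 {f : (Fin 2 → ℝ) → ℝ} (hf : ContDiff ℝ 1 f) (j : Fin 2) :
    Continuous (pderiv2 j f) :=
  (hf.continuous_fderiv one_ne_zero).clm_apply continuous_const

lemma hasCompactSupport_pderiv2 {f : (Fin 2 → ℝ) → ℝ} (hf : HasCompactSupport f) (j : Fin 2) :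
    HasCompactSupport (pderiv2 j f) :=
  hf.fderiv_apply ℝ (Pi.single j 1)

/-- A form of Ladyzhenskaya's inequality on the plane. -/
lemma integral_pow_four_le {f : (Fin 2 → ℝ) → ℝ} (hf : ContDiff ℝ 1 f)
    (hcf : HasCompactSupport f) :
    ∫ x, f x ^ 4 ≤ (2 * (∫ x, f x ^ 2) + ∑ j : Fin 2, ∫ x, pderiv2 j f x ^ 2) ^ 2 := by
  have hd := fun j => continuous_pderiv2 hf j
  have hdc := fun j => hasCompactSupport_pderiv2 hcf j
  have iff : Integrable (fun x => f x ^ 2) :=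
    integrable_fun_pow hf.continuous hcf (by norm_num)
  have idd : ∀ j, Integrable (fun x => pderiv2 j f x ^ 2) := fun j =>
    integrable_fun_pow (hd j) (hdc j) (by norm_num)
  have igrad : Integrable fun x => pderiv2 0 f x ^ 2 + pderiv2 1 f x ^ 2 :=
    (idd 0).add (idd 1)
  have isum : Integrable fun x => 2 * f x ^ 2 + (pderiv2 0 f x ^ 2 + pderiv2 1 f x ^ 2) :=
    (iff.const_mul 2).add igrad
  have if4 : Integrable (fun x => f x ^ 4) :=
    integrable_fun_pow hf.continuous hcf (by norm_num)
  have hp : Real.HolderConjugate (Fintype.card (Fin 2)) 2 := by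
    simpa using Real.HolderConjugate.two_two
  have key := lintegral_pow_le_pow_lintegral_fderiv_aux hp (hf.pow 2)
    (hasCompactSupport_fun_pow hcf two_ne_zero)
  have hpt : ∀ x, ‖fderiv ℝ (fun y => f y ^ 2) x‖
      ≤ 2 * f x ^ 2 + (pderiv2 0 f x ^ 2 + pderiv2 1 f x ^ 2) := by
    intro x
    have hdiff : DifferentiableAt ℝ f x := (hf.differentiable one_ne_zero) x
    rw [fderiv_fun_pow 2 hdiff, norm_smul]
    have hn := norm_le_sum_abs_apply_single (fderiv ℝ f x)
    change _ ≤ |pderiv2 0 f x| + |pderiv2 1 f x| at hn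
    have : ‖(2 • f x ^ (2 - 1) : ℝ)‖ = 2 * |f x| := by simp
    rw [this, ← sq_abs (f x), ← sq_abs (pderiv2 0 f x), ← sq_abs (pderiv2 1 f x)]
    have := mul_le_mul_of_nonneg_left hn (by positivity : 0 ≤ 2 * |f x|)
    nlinarith [sq_nonneg (|f x| - |pderiv2 0 f x|), sq_nonneg (|f x| - |pderiv2 1 f x|)]
  have hR : 0 ≤ 2 * (∫ x, f x ^ 2) + ∑ j : Fin 2, ∫ x, pderiv2 j f x ^ 2 := by
    have := integral_nonneg (μ := volume) (f := fun x => f x ^ 2) fun x => sq_nonneg _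
    have := Finset.sum_nonneg (s := Finset.univ) (f := fun j => ∫ x, pderiv2 j f x ^ 2)
      fun j _ => integral_nonneg fun x => sq_nonneg _
    positivity
  have hint : ∫⁻ x, ‖fderiv ℝ (fun y => f y ^ 2) x‖ₑ
      ≤ ENNReal.ofReal (2 * (∫ x, f x ^ 2) + ∑ j : Fin 2, ∫ x, pderiv2 j f x ^ 2) := by
    have : 2 * (∫ x, f x ^ 2) + ∑ j : Fin 2, ∫ x, pderiv2 j f x ^ 2
        = ∫ x, (2 * f x ^ 2 + (pderiv2 0 f x ^ 2 + pderiv2 1 f x ^ 2)) := by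
      rw [integral_add (iff.const_mul 2) igrad, integral_add (idd 0) (idd 1),
        integral_const_mul, Fin.sum_univ_two]
    rw [this, ofReal_integral_eq_lintegral_ofReal isum
      (Filter.Eventually.of_forall fun x => by positivity)]
    refine lintegral_mono fun x => ?_
    rw [← ofReal_norm]
    exact ENNReal.ofReal_le_ofReal (hpt x)
  rw [← ENNReal.ofReal_le_ofReal_iff (sq_nonneg _), ENNReal.ofReal_pow hR,
    ofReal_integral_eq_lintegral_ofReal if4
      (Filter.Eventually.of_forall fun x => by positivity)]
  calc ∫⁻ x, ENNReal.ofReal (f x ^ 4) = ∫⁻ x, ‖f x ^ 2‖ₑ ^ (2 : ℝ) := by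
        refine lintegral_congr fun x => ?_
        rw [ENNReal.rpow_two, ← ofReal_norm, ← ENNReal.ofReal_pow (norm_nonneg _),
          Real.norm_eq_abs, sq_abs]
        ring_nf
    _ ≤ _ := key
    _ ≤ _ := by
        rw [ENNReal.rpow_two]
        gcongr

lemma abs_integral_mul_mul_le {f g h : (Fin 2 → ℝ) → ℝ} {a b c : ℝ}
    (hf : Continuous f) (hg : Continuous g) (hh : Continuous h)
    (hcf : HasCompactSupport f) (hcg : HasCompactSupport g) (hch : HasCompactSupport h)
    (ha : 0 ≤ a) (hb : 0 ≤ b) (hc : 0 ≤ c)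
    (hfa : ∫ x, f x ^ 4 ≤ (2 * a ^ 2) ^ 2) (hgb : ∫ x, g x ^ 2 ≤ b ^ 2)
    (hhc : ∫ x, h x ^ 4 ≤ (2 * c ^ 2) ^ 2) :
    |∫ x, f x * g x * h x| ≤ 2 * a * b * c := by
  have h1 := sq_integral_mul_le hg (hf.mul hh) hcg (hcf.mul_right (f' := h))
  have h2 := sq_integral_mul_le (hf.pow 2) (hh.pow 2)
    (hasCompactSupport_fun_pow hcf two_ne_zero) (hasCompactSupport_fun_pow hch two_ne_zero)
  have e1 : ∀ x, g x * (f x * h x) = f x * g x * h x := fun x => by ring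
  have e2 : ∀ x, (f x * h x) ^ 2 = f x ^ 2 * h x ^ 2 := fun x => by ring
  simp only [Pi.mul_apply, Pi.pow_apply, e1, e2, ← pow_mul, Nat.reduceMul] at h1 h2
  have h3 : ∫ x, f x ^ 2 * h x ^ 2 ≤ 4 * a ^ 2 * c ^ 2 := by
    refine le_of_sq_le_sq ?_ (by positivity)
    calc _ ≤ _ := h2
      _ ≤ (2 * a ^ 2) ^ 2 * (2 * c ^ 2) ^ 2 := by
        gcongr
      _ = _ := by ring
  refine abs_le_of_sq_le_sq ?_ (by positivity)
  calc _ ≤ _ := h1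
    _ ≤ b ^ 2 * (4 * a ^ 2 * c ^ 2) := by
      gcongr
    _ = _ := by ring

lemma l2normSq_nonneg (u : (Fin 2 → ℝ) → (Fin 2 → ℝ)) : 0 ≤ l2normSq u :=
  integral_nonneg fun _ => Finset.sum_nonneg fun _ _ => sq_nonneg _

lemma gradL2normSq_nonneg (u : (Fin 2 → ℝ) → (Fin 2 → ℝ)) : 0 ≤ gradL2normSq u :=
  Finset.sum_nonneg fun _ _ => Finset.sum_nonneg fun _ _ => integral_nonneg fun _ => sq_nonneg _

lemma h1norm_sq (u : (Fin 2 → ℝ) → (Fin 2 → ℝ)) :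
    h1norm u ^ 2 = l2normSq u + gradL2normSq u :=
  Real.sq_sqrt (add_nonneg (l2normSq_nonneg u) (gradL2normSq_nonneg u))

lemma sum_integral_pderiv2_sq_le (u : (Fin 2 → ℝ) → (Fin 2 → ℝ)) (i : Fin 2) :
    ∑ j : Fin 2, ∫ x, pderiv2 j (fun y => u y i) x ^ 2 ≤ gradL2normSq u :=
  Finset.single_le_sum (f := fun i => ∑ j : Fin 2, ∫ x, pderiv2 j (fun y => u y i) x ^ 2)
    (fun _ _ => Finset.sum_nonneg fun _ _ => integral_nonneg fun _ => sq_nonneg _)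
    (Finset.mem_univ i)

lemma integral_pderiv2_sq_le (u : (Fin 2 → ℝ) → (Fin 2 → ℝ)) (i j : Fin 2) :
    ∫ x, pderiv2 j (fun y => u y i) x ^ 2 ≤ h1norm u ^ 2 := by
  have h := Finset.single_le_sum (f := fun j => ∫ x, pderiv2 j (fun y => u y i) x ^ 2)
    (fun _ _ => integral_nonneg fun _ => sq_nonneg _) (Finset.mem_univ j)
  have h' := sum_integral_pderiv2_sq_le u i
  have := l2normSq_nonneg u
  rw [h1norm_sq]
  linarith

lemma hasCompactSupport_component {u : (Fin 2 → ℝ) → (Fin 2 → ℝ)} (hu : HasCompactSupport u)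
    (i : Fin 2) : HasCompactSupport fun y => u y i :=
  hu.comp_left (g := fun z : Fin 2 → ℝ => z i) rfl

lemma integral_component_pow_four_le {u : (Fin 2 → ℝ) → (Fin 2 → ℝ)} (hu : ContDiff ℝ 1 u)
    (hcu : HasCompactSupport u) (i : Fin 2) :
    ∫ x, u x i ^ 4 ≤ (2 * h1norm u ^ 2) ^ 2 := by
  have hi : ∀ k, ContDiff ℝ 1 fun y => u y k := fun k => contDiff_pi.1 hu k
  have hint : ∀ k, Integrable fun x => u x k ^ 2 := fun k =>
    integrable_fun_pow (hi k).continuous (hasCompactSupport_component hcu k) two_ne_zero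
  have hL : ∫ x, u x i ^ 2 ≤ l2normSq u := by
    refine integral_mono (hint i) (integrable_finsetSum _ fun k _ => hint k) fun x => ?_
    exact Finset.single_le_sum (f := fun k => u x k ^ 2) (fun _ _ => sq_nonneg _)
      (Finset.mem_univ i)
  refine (integral_pow_four_le (hi i) (hasCompactSupport_component hcu i)).trans ?_
  have h0 : 0 ≤ ∫ x, u x i ^ 2 := integral_nonneg fun _ => sq_nonneg _
  have h1 : 0 ≤ ∑ j : Fin 2, ∫ x, pderiv2 j (fun y => u y i) x ^ 2 :=
    Finset.sum_nonneg fun _ _ => integral_nonneg fun _ => sq_nonneg _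
  have h2 := sum_integral_pderiv2_sq_le u i
  have h3 := gradL2normSq_nonneg u
  rw [h1norm_sq]
  gcongr
  linarith

/-- Proposition 2.1(i): for every bounded open `D ⊆ ℝ²` there is `C ≥ 0` with
`|b̂(u,v,w)| ≤ C ‖u‖_{H¹} ‖v‖_{H¹} ‖w‖_{H¹}` for all smooth compactly supported
fields supported in `D`, i.e. `b̂` is continuous in the `H¹`-norm. -/
theorem bhat_continuous (D : Set (Fin 2 → ℝ)) (hD : IsOpen D)
    (hDb : Bornology.IsBounded D) :
    ∃ C : ℝ, 0 ≤ C ∧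
      ∀ u v w : (Fin 2 → ℝ) → (Fin 2 → ℝ),
        ContDiff ℝ (⊤ : ℕ∞) u → ContDiff ℝ (⊤ : ℕ∞) v → ContDiff ℝ (⊤ : ℕ∞) w →
        HasCompactSupport u → HasCompactSupport v → HasCompactSupport w →
        tsupport u ⊆ D → tsupport v ⊆ D → tsupport w ⊆ D →
        |bhat u v w| ≤ C * h1norm u * h1norm v * h1norm w := by
  refine ⟨12, by norm_num, fun u v w hu hv hw hcu hcv hcw _ _ _ => ?_⟩
  replace hu : ContDiff ℝ 1 u := hu.of_le (by exact_mod_cast le_top)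
  replace hv : ContDiff ℝ 1 v := hv.of_le (by exact_mod_cast le_top)
  replace hw : ContDiff ℝ 1 w := hw.of_le (by exact_mod_cast le_top)
  have nonneg : ∀ z, 0 ≤ h1norm z := fun z => Real.sqrt_nonneg _
  have ctu : ∀ i, ContDiff ℝ 1 fun y => u y i := fun i => contDiff_pi.1 hu i
  have ctv : ∀ i, ContDiff ℝ 1 fun y => v y i := fun i => contDiff_pi.1 hv i
  have ctw : ∀ i, ContDiff ℝ 1 fun y => w y i := fun i => contDiff_pi.1 hw i
  have ccu := hasCompactSupport_component hcu
  have ccv := hasCompactSupport_component hcv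
  have ccw := hasCompactSupport_component hcw
  have adv_int : ∀ i j, Integrable fun x => u x j * pderiv2 j (fun y => v y i) x * w x i :=
    fun i j => (((ctu j).continuous.mul (continuous_pderiv2 (ctv i) j)).mul
      (ctw i).continuous).integrable_of_hasCompactSupport (ccw i).mul_left
  have div_int : ∀ i j, Integrable fun x => v x i * pderiv2 j (fun y => u y j) x * w x i :=
    fun i j => (((ctv i).continuous.mul (continuous_pderiv2 (ctu j) j)).mul
      (ctw i).continuous).integrable_of_hasCompactSupport (ccw i).mul_left
  have adv_le : ∀ i j, |∫ x, u x j * pderiv2 j (fun y => v y i) x * w x i|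
      ≤ 2 * h1norm u * h1norm v * h1norm w := fun i j =>
    abs_integral_mul_mul_le (ctu j).continuous (continuous_pderiv2 (ctv i) j) (ctw i).continuous
      (ccu j) (hasCompactSupport_pderiv2 (ccv i) j) (ccw i) (nonneg u) (nonneg v) (nonneg w)
      (integral_component_pow_four_le hu hcu j) (integral_pderiv2_sq_le v i j)
      (integral_component_pow_four_le hw hcw i)
  have div_le : ∀ i j, |∫ x, v x i * pderiv2 j (fun y => u y j) x * w x i|
      ≤ 2 * h1norm v * h1norm u * h1norm w := fun i j =>
    abs_integral_mul_mul_le (ctv i).continuous (continuous_pderiv2 (ctu j) j) (ctw i).continuous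
      (ccv i) (hasCompactSupport_pderiv2 (ccu j) j) (ccw i) (nonneg v) (nonneg u) (nonneg w)
      (integral_component_pow_four_le hv hcv i) (integral_pderiv2_sq_le u j j)
      (integral_component_pow_four_le hw hcw i)
  have adv_eq : (∫ x : Fin 2 → ℝ,
      ∑ i : Fin 2, (∑ j : Fin 2, u x j * pderiv2 j (fun y => v y i) x) * w x i)
      = ∑ i : Fin 2, ∑ j : Fin 2, ∫ x, u x j * pderiv2 j (fun y => v y i) x * w x i := by
    simp_rw [Finset.sum_mul]
    rw [integral_finsetSum _ fun i _ => integrable_finsetSum _ fun j _ => adv_int i j]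
    exact Finset.sum_congr rfl fun i _ => integral_finsetSum _ fun j _ => adv_int i j
  have div_eq : (∫ x : Fin 2 → ℝ,
      (∑ j : Fin 2, pderiv2 j (fun y => u y j) x) * (∑ i : Fin 2, v x i * w x i))
      = ∑ i : Fin 2, ∑ j : Fin 2, ∫ x, v x i * pderiv2 j (fun y => u y j) x * w x i := by
    have : ∀ x, (∑ j : Fin 2, pderiv2 j (fun y => u y j) x) * (∑ i : Fin 2, v x i * w x i)
        = ∑ i : Fin 2, ∑ j : Fin 2, v x i * pderiv2 j (fun y => u y j) x * w x i := fun x => by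
      simp only [Fin.sum_univ_two]
      ring
    simp_rw [this]
    rw [integral_finsetSum _ fun i _ => integrable_finsetSum _ fun j _ => div_int i j]
    exact Finset.sum_congr rfl fun i _ => integral_finsetSum _ fun j _ => div_int i j
  have sum_le : ∀ (F : Fin 2 → Fin 2 → ℝ) (M : ℝ), (∀ i j, |F i j| ≤ M) →
      |∑ i, ∑ j, F i j| ≤ 4 * M := by
    intro F M hF
    simp only [Fin.sum_univ_two]
    have h00 := abs_le.1 (hF 0 0)
    have h01 := abs_le.1 (hF 0 1)
    have h10 := abs_le.1 (hF 1 0)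
    have h11 := abs_le.1 (hF 1 1)
    rw [abs_le]
    constructor <;> linarith
  have hA := abs_le.1 (sum_le _ _ adv_le)
  have hB := abs_le.1 (sum_le _ _ div_le)
  have hcomm : h1norm v * h1norm u = h1norm u * h1norm v := mul_comm _ _
  rw [mul_assoc 2 (h1norm v), hcomm, ← mul_assoc] at hB
  rw [bhat, adv_eq, div_eq, abs_le]
  constructor <;> linarith
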